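/- arXiv:1902.08406 — 4 statements merged into one kernel-verified Lean document; each statement's English description precedes it below -/
import Mathlib

section
/- Let A* be a Poincaré DGCA of degree n of Hodge type, with operator d⁻ associated to a Hodge type decomposition. Then the null space A*⊥ is a d-invariant ideal of A* which is also invariant under d⁻, it decomposes as a direct sum A*⊥ = dd⁻(A*⊥) ⊕ d⁻d(A*⊥), and the cochain complex (A*⊥, d) has trivial cohomology; indeed the identity map of A*⊥ equals dd⁻ + d⁻d there, so it is null-homotopic. -/
universe u v

open scoped TensorProduct

/-- A (not necessarily commutative) differential graded algebra over `F`: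
a nonnegatively graded, associative, unital `F`-algebra equipped with a degree `+1`
differential `d` satisfying `d ∘ d = 0` and the graded Leibniz rule. -/
structure DGA (F : Type u) (A : Type v) [Field F] [Ring A] [Algebra F A] where
  grading : ℤ → Submodule F A
  internal : DirectSum.IsInternal grading
  nonneg : ∀ i : ℤ, i < 0 → grading i = ⊥
  one_mem : (1 : A) ∈ grading 0
  mul_mem : ∀ {i j : ℤ} {a b : A}, a ∈ grading i → b ∈ grading j → a * b ∈ grading (i + j)
  d : A →ₗ[F] A
  d_mem : ∀ {i : ℤ} {a : A}, a ∈ grading i → d a ∈ grading (i + 1)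
  d_d : ∀ a : A, d (d a) = 0
  leibniz : ∀ {i : ℤ} (a b : A), a ∈ grading i →
    d (a * b) = d a * b + ((-1 : F) ^ i) • (a * d b)

namespace DGA

variable {F : Type u} {A : Type v} [Field F] [Ring A] [Algebra F A]

/-- The cocycles of degree `k`. -/
def Zc (D : DGA F A) (k : ℤ) : Submodule F A := D.grading k ⊓ LinearMap.ker D.d

/-- The coboundaries of degree `k`. -/
def Bc (D : DGA F A) (k : ℤ) : Submodule F A := Submodule.map D.d (D.grading (k - 1))

/-- `a` is exact, i.e. a coboundary. -/
def IsExact (D : DGA F A) (a : A) : Prop := ∃ b, a = D.d b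

/-- Two elements define the same cohomology class. -/
def Cohomologous (D : DGA F A) (a b : A) : Prop := ∃ c, a - b = D.d c

/-- `H^0 = F·[1]`. -/
def Connected (D : DGA F A) : Prop :=
  ∀ a ∈ D.grading 0, D.d a = 0 → ∃ c : F, a = c • (1 : A)

/-- Connected and `H^k = 0` for `1 ≤ k ≤ r`.  An `(r-1)`-connected DGA in the sense of
the paper is one satisfying `RConnected (r-1)`. -/
def RConnected (D : DGA F A) (r : ℤ) : Prop :=
  D.Connected ∧ ∀ k : ℤ, 1 ≤ k → k ≤ r → ∀ a ∈ D.grading k, D.d a = 0 → D.IsExact a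

/-- A harmonic subspace: a graded complement of the coboundaries inside the cocycles. -/
def IsHarmonicFamily (D : DGA F A) (H : ℤ → Submodule F A) : Prop :=
  ∀ k : ℤ, H k ≤ D.Zc k ∧ Disjoint (D.Bc k) (H k) ∧ D.Zc k ≤ D.Bc k ⊔ H k

/-- The operator `d⁻` attached to a decomposition `A = dA ⊕ H ⊕ B`: the inverse of
`d : B → dA` extended by `0` on `H ⊕ B`. -/
def IsDminus (D : DGA F A) (H B : ℤ → Submodule F A) (dm : A →ₗ[F] A) : Prop :=
  (∀ k : ℤ, ∀ b ∈ B k, dm (D.d b) = b) ∧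
  (∀ k : ℤ, ∀ h ∈ H k, dm h = 0) ∧
  (∀ k : ℤ, ∀ b ∈ B k, dm b = 0) ∧
  (∀ k : ℤ, ∀ a ∈ D.grading k, dm a ∈ B (k - 1))

/-- The projection `π_H : A → H` with kernel `dA ⊕ B`. -/
def IsHarmonicProj (D : DGA F A) (H B : ℤ → Submodule F A) (pH : A →ₗ[F] A) : Prop :=
  (∀ k : ℤ, ∀ h ∈ H k, pH h = h) ∧
  (∀ k : ℤ, ∀ b ∈ B k, pH b = 0) ∧
  (∀ a : A, pH (D.d a) = 0) ∧
  (∀ k : ℤ, ∀ a ∈ D.grading k, pH a ∈ H k)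

/-- The degree of the entry `a i j` of a defining system: `|x_i| + ⋯ + |x_j| - (j - i)`. -/
def degSum (deg : ℕ → ℤ) (i j : ℕ) : ℤ :=
  (∑ t ∈ Finset.Icc i j, deg t) - ((j - i : ℕ) : ℤ)

/-- A defining system for the `l`-th order Massey product of the classes of the
cocycles `x 1, …, x l` (of degrees `deg 1, …, deg l`). -/
def IsDefiningSystem (D : DGA F A) (l : ℕ) (deg : ℕ → ℤ) (x : ℕ → A)
    (a : ℕ → ℕ → A) : Prop :=
  (∀ i : ℕ, 1 ≤ i → i ≤ l →
      a i i ∈ D.grading (deg i) ∧ D.d (a i i) = 0 ∧ D.Cohomologous (a i i) (x i)) ∧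
  (∀ i j : ℕ, 1 ≤ i → i ≤ j → j ≤ l → a i j ∈ D.grading (degSum deg i j)) ∧
  (∀ i j : ℕ, 1 ≤ i → i < j → j ≤ l → ¬(i = 1 ∧ j = l) →
    D.d (a i j) = ∑ k ∈ Finset.Ico i j, ((-1 : F) ^ degSum deg i k) • (a i k * a (k + 1) j))

/-- The cocycle `∑ ā_{1k} a_{k+1,l}` produced by a defining system. -/
def masseyOut (D : DGA F A) (l : ℕ) (deg : ℕ → ℤ) (a : ℕ → ℕ → A) : A :=
  ∑ k ∈ Finset.Ico 1 l, ((-1 : F) ^ degSum deg 1 k) • (a 1 k * a (k + 1) l)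

/-- `(x 1, …, x l)` is a Massey `l`-tuple: the Massey product is nonempty. -/
def IsMasseyTuple (D : DGA F A) (l : ℕ) (deg : ℕ → ℤ) (x : ℕ → A) : Prop :=
  (∀ i : ℕ, 1 ≤ i → i ≤ l → x i ∈ D.Zc (deg i)) ∧ ∃ a, D.IsDefiningSystem l deg x a

/-- The `l`-th order Massey product of `(x 1, …, x l)` is trivial: it contains `0`. -/
def MasseyTrivial (D : DGA F A) (l : ℕ) (deg : ℕ → ℤ) (x : ℕ → A) : Prop :=
  ∃ a, D.IsDefiningSystem l deg x a ∧ D.IsExact (D.masseyOut l deg a)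

end DGA

/-- A differential graded commutative algebra (DGCA) over `F`. -/
structure DGCA (F : Type u) (A : Type v) [Field F] [Ring A] [Algebra F A]
    extends DGA F A where
  gcomm : ∀ {i j : ℤ} (a b : A), a ∈ grading i → b ∈ grading j →
    a * b = ((-1 : F) ^ (i * j)) • (b * a)

/-- A Poincaré DGCA of degree `n`: a DGCA concentrated in degrees `0, …, n`, with finite
dimensional cohomology, equipped with a linear functional `∫` (given here as `intg`, a
functional on `A` vanishing in degrees `≠ n` and on coboundaries) such that the induced
pairing `⟨a, b⟩ = ∫ [a * b]` is nondegenerate on cohomology. -/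
structure PoincareDGCA (F : Type u) (A : Type v) [Field F] [Ring A] [Algebra F A]
    (n : ℤ) extends DGCA F A where
  top : ∀ i : ℤ, n < i → grading i = ⊥
  fin_cohomology : ∀ k : ℤ, ∃ W : Submodule F A, FiniteDimensional F W ∧
    ∀ a ∈ grading k, d a = 0 → ∃ w ∈ W, ∃ c, a - w = d c
  intg : A →ₗ[F] F
  intg_deg : ∀ i : ℤ, i ≠ n → ∀ a ∈ grading i, intg a = 0
  intg_d : ∀ a : A, intg (d a) = 0
  nondeg : ∀ i : ℤ, ∀ a ∈ grading i, d a = 0 →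
    (∀ b ∈ grading (n - i), d b = 0 → intg (a * b) = 0) → ∃ c, a = d c

namespace PoincareDGCA

variable {F : Type u} {A : Type v} [Field F] [Ring A] [Algebra F A] {n : ℤ}

/-- The null space `A⊥` of the induced pairing `⟨a, b⟩ = ∫ (a * b)` on `A`. -/
def perp (P : PoincareDGCA F A n) : Submodule F A :=
  ⨅ b : A, LinearMap.ker (P.intg ∘ₗ LinearMap.mulRight F b)

/-- `A = dA ⊕ H ⊕ B` is a Hodge type decomposition: `H` is a harmonic subspace,
`B` is a graded complement, and `⟨H ⊕ B, B⟩ = 0`. -/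
def IsHodge (P : PoincareDGCA F A n) (H B : ℤ → Submodule F A) : Prop :=
  P.toDGA.IsHarmonicFamily H ∧
  (∀ k : ℤ, B k ≤ P.grading k) ∧
  (∀ k : ℤ, Disjoint (P.toDGA.Bc k ⊔ H k) (B k)) ∧
  (∀ k : ℤ, P.grading k ≤ P.toDGA.Bc k ⊔ H k ⊔ B k) ∧
  (∀ j k : ℤ, ∀ a ∈ H j ⊔ B j, ∀ b ∈ B k, P.intg (a * b) = 0)

/-- A Poincaré DGCA of Hodge type: one admitting a Hodge type decomposition. -/
def HodgeType (P : PoincareDGCA F A n) : Prop := ∃ H B, P.IsHodge H B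

end PoincareDGCA

/-- A bundled DGCA over `F`. -/
structure BDGCA (F : Type u) [Field F] : Type (max (u + 1) (v + 1)) where
  carrier : Type v
  [ringInst : Ring carrier]
  [algInst : Algebra F carrier]
  str : DGCA F carrier

attribute [instance] BDGCA.ringInst BDGCA.algInst

/-- A morphism of DGCAs: an algebra homomorphism preserving the grading and
commuting with the differentials. -/
structure DGCAHom {F : Type u} [Field F] (X Y : BDGCA.{u, v} F) where
  f : X.carrier →ₐ[F] Y.carrier
  map_grading : ∀ i : ℤ, ∀ a ∈ X.str.grading i, f a ∈ Y.str.grading i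
  map_d : ∀ a, f (X.str.d a) = Y.str.d (f a)

/-- A quasi-isomorphism: a DGCA morphism inducing an isomorphism on cohomology. -/
def DGCAHom.QuasiIso {F : Type u} [Field F] {X Y : BDGCA.{u, v} F}
    (φ : DGCAHom X Y) : Prop :=
  (∀ i : ℤ, ∀ a ∈ X.str.grading i, X.str.d a = 0 →
    (∃ b, φ.f a = Y.str.d b) → ∃ c, a = X.str.d c) ∧
  (∀ i : ℤ, ∀ a' ∈ Y.str.grading i, Y.str.d a' = 0 →
    ∃ a ∈ X.str.grading i, X.str.d a = 0 ∧ ∃ b, φ.f a - a' = Y.str.d b)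

/-- Two DGCAs are equivalent if they are joined by a finite zig-zag of
quasi-isomorphisms. -/
def DGCAEquivalent {F : Type u} [Field F] : BDGCA.{u, v} F → BDGCA.{u, v} F → Prop :=
  Relation.EqvGen fun X Y => ∃ φ : DGCAHom X Y, φ.QuasiIso

/-- A DGCA is formal if it is equivalent to a DGCA with zero differential
(equivalently, to its cohomology with the zero differential). -/
def DGCAFormal {F : Type u} [Field F] (X : BDGCA.{u, v} F) : Prop :=
  ∃ Y : BDGCA.{u, v} F, Y.str.d = 0 ∧ DGCAEquivalent X Y

namespace DGA

variable {F : Type u} {A : Type v} [Field F] [Ring A] [Algebra F A]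

/-- A property closed under linear combinations holds everywhere if it holds on
homogeneous elements. -/
theorem mem_of_homogeneous (D : DGA F A) (S : Submodule F A)
    (hS : ∀ i, ∀ a ∈ D.grading i, a ∈ S) (a : A) : a ∈ S := by
  have h : (⨆ i, D.grading i) ≤ S := iSup_le hS
  rw [D.internal.submodule_iSup_eq_top] at h
  exact h Submodule.mem_top

/-- Two linear maps agreeing on homogeneous elements are equal. -/
theorem linearMap_ext (D : DGA F A) {M : Type*} [AddCommGroup M] [Module F M]
    {f g : A →ₗ[F] M} (h : ∀ i, ∀ a ∈ D.grading i, f a = g a) (a : A) : f a = g a :=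
  D.mem_of_homogeneous (LinearMap.eqLocus f g) h a

end DGA

namespace PoincareDGCA

variable {F : Type u} {A : Type v} [Field F] [Ring A] [Algebra F A] {n : ℤ}

theorem mem_perp (P : PoincareDGCA F A n) {a : A} :
    a ∈ P.perp ↔ ∀ b, P.intg (a * b) = 0 := by
  simp [perp, Submodule.mem_iInf]

theorem mem_perp_of_homogeneous (P : PoincareDGCA F A n) {a : A}
    (h : ∀ j, ∀ b ∈ P.grading j, P.intg (a * b) = 0) : a ∈ P.perp :=
  P.mem_perp.2 fun b =>
    P.linearMap_ext (f := P.intg ∘ₗ LinearMap.mulLeft F a) (g := 0) h b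

/-- The null space is a graded subspace. -/
theorem perp_le_iSup (P : PoincareDGCA F A n) :
    P.perp ≤ ⨆ i, P.perp ⊓ P.grading i := by
  classical
  intro a ha
  let _ := P.internal.chooseDecomposition
  rw [← DirectSum.sum_support_decompose P.grading a]
  refine Submodule.sum_mem _ fun i hi => Submodule.mem_iSup_of_mem i ⟨?_, SetLike.coe_mem _⟩
  refine P.mem_perp_of_homogeneous fun j b hb => ?_
  by_cases hij : i + j = n
  · have hab := P.mem_perp.1 ha b
    rw [← DirectSum.sum_support_decompose P.grading a, Finset.sum_mul, map_sum,
      Finset.sum_eq_single_of_mem i hi] at hab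
    · exact hab
    · intro k _ hk
      exact P.intg_deg (k + j) (by omega) _ (P.mul_mem (SetLike.coe_mem _) hb)
  · exact P.intg_deg _ hij _ (P.mul_mem (SetLike.coe_mem _) hb)

theorem perp_le_of_homogeneous (P : PoincareDGCA F A n) {S : Submodule F A}
    (h : ∀ i, ∀ a ∈ P.perp, a ∈ P.grading i → a ∈ S) : P.perp ≤ S :=
  P.perp_le_iSup.trans (iSup_le fun i a ha => h i a ha.1 ha.2)

theorem mul_mem_perp (P : PoincareDGCA F A n) {a : A} (ha : a ∈ P.perp) (x : A) :
    a * x ∈ P.perp :=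
  P.mem_perp.2 fun b => by rw [mul_assoc]; exact P.mem_perp.1 ha _

theorem mem_perp_mul (P : PoincareDGCA F A n) {a : A} (ha : a ∈ P.perp) (x : A) :
    x * a ∈ P.perp := by
  refine P.perp_le_of_homogeneous (S := P.perp.comap (LinearMap.mulLeft F x))
    (fun i a ha hi => ?_) ha
  refine P.mem_of_homogeneous (P.perp.comap (LinearMap.mulRight F a)) (fun j x hx => ?_) x
  simp only [Submodule.mem_comap, LinearMap.mulRight_apply]
  rw [P.gcomm x a hx hi]
  exact P.perp.smul_mem _ (P.mul_mem_perp ha x)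

/-- Integration by parts: `∫ da * b = ∓ ∫ a * db`. -/
theorem intg_d_mul (P : PoincareDGCA F A n) {i : ℤ} {a : A} (ha : a ∈ P.grading i) (b : A) :
    P.intg (P.d a * b) = -((-1 : F) ^ i * P.intg (a * P.d b)) := by
  have h := P.intg_d (a * b)
  rw [P.leibniz a b ha, map_add, map_smul, smul_eq_mul] at h
  exact eq_neg_of_add_eq_zero_left h

theorem d_mem_perp (P : PoincareDGCA F A n) {a : A} (ha : a ∈ P.perp) : P.d a ∈ P.perp := by
  refine P.perp_le_of_homogeneous (S := P.perp.comap P.d) (fun i a ha hi => ?_) ha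
  refine P.mem_perp.2 fun b => ?_
  rw [P.intg_d_mul hi, P.mem_perp.1 ha, mul_zero, neg_zero]

variable {P : PoincareDGCA F A n} {H B : ℤ → Submodule F A} {dm : A →ₗ[F] A}

theorem IsHodge.exists_decomp (hP : P.IsHodge H B) {k : ℤ} {a : A} (ha : a ∈ P.grading k) :
    ∃ c ∈ P.grading (k - 1), ∃ h ∈ H k, ∃ b ∈ B k, a = P.d c + h + b := by
  obtain ⟨y, hy, b, hb, rfl⟩ := Submodule.mem_sup.1 (hP.2.2.2.1 k ha)
  obtain ⟨_, ⟨c, hc, rfl⟩, h, hh, rfl⟩ := Submodule.mem_sup.1 hy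
  exact ⟨c, hc, h, hh, b, hb, rfl⟩

theorem IsHodge.harmonic_mem_grading (hP : P.IsHodge H B) {k : ℤ} {h : A} (hh : h ∈ H k) :
    h ∈ P.grading k := ((hP.1 k).1 hh).1

theorem IsHodge.d_harmonic (hP : P.IsHodge H B) {k : ℤ} {h : A} (hh : h ∈ H k) :
    P.d h = 0 := ((hP.1 k).1 hh).2

/-- Every coboundary of degree `k` is the differential of an element of `B`. -/
theorem IsHodge.exists_d_eq (hP : P.IsHodge H B) {k : ℤ} {c : A} (hc : c ∈ P.grading k) :
    ∃ b ∈ B k, P.d c = P.d b := by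
  obtain ⟨e, -, h, hh, b, hb, rfl⟩ := hP.exists_decomp hc
  exact ⟨b, hb, by simp [P.d_d, hP.d_harmonic hh]⟩

theorem IsHodge.intg_mul_eq_zero (hP : P.IsHodge H B) {j k : ℤ} {a b : A}
    (ha : a ∈ H j ⊔ B j) (hb : b ∈ B k) : P.intg (a * b) = 0 :=
  hP.2.2.2.2 j k a ha b hb

theorem IsHodge.intg_mul_eq_zero' (hP : P.IsHodge H B) {j k : ℤ} {a b : A}
    (ha : a ∈ H j ⊔ B j) (hb : b ∈ B k) : P.intg (b * a) = 0 := by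
  have haj : a ∈ P.grading j :=
    sup_le (fun _ => hP.harmonic_mem_grading) (hP.2.1 j) ha
  rw [P.gcomm b a (hP.2.1 k hb) haj, map_smul, hP.intg_mul_eq_zero ha hb, smul_zero]

/-- `d d⁻ d = d`. -/
theorem IsHodge.d_dm_d (hP : P.IsHodge H B) (hdm : P.toDGA.IsDminus H B dm) (a : A) :
    P.d (dm (P.d a)) = P.d a := by
  refine P.linearMap_ext (f := P.d ∘ₗ dm ∘ₗ P.d) (g := P.d) (fun i a ha => ?_) a
  obtain ⟨b, hb, h⟩ := hP.exists_d_eq ha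
  simp only [LinearMap.comp_apply]
  rw [h, hdm.1 i b hb]

/-- `d⁻ d⁻ = 0`. -/
theorem dm_dm (hdm : P.toDGA.IsDminus H B dm) (a : A) : dm (dm a) = 0 :=
  P.linearMap_ext (f := dm ∘ₗ dm) (g := 0)
    (fun i a ha => hdm.2.2.1 (i - 1) _ (hdm.2.2.2 i a ha)) a

/-- The Hodge decomposition of a homogeneous element, with exact part `d d⁻ a`, and
`B`-part `d⁻ d a`. -/
theorem IsHodge.exists_harmonic (hP : P.IsHodge H B) (hdm : P.toDGA.IsDminus H B dm) {k : ℤ}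
    {a : A} (ha : a ∈ P.grading k) :
    ∃ h ∈ H k, dm (P.d a) ∈ B k ∧ a = P.d (dm a) + h + dm (P.d a) := by
  obtain ⟨c, -, h, hh, b, hb, rfl⟩ := hP.exists_decomp ha
  have h₁ : dm (P.d (P.d c + h + b)) = b := by
    simp [P.d_d, hP.d_harmonic hh, hdm.1 k b hb]
  have h₂ : P.d (dm (P.d c + h + b)) = P.d c := by
    simp [hdm.2.1 k h hh, hdm.2.2.1 k b hb, hP.d_dm_d hdm]
  exact ⟨h, hh, h₁.symm ▸ hb, by rw [h₁, h₂]⟩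

theorem IsHodge.dm_mem_perp (hP : P.IsHodge H B) (hdm : P.toDGA.IsDminus H B dm) {a : A}
    (ha : a ∈ P.perp) : dm a ∈ P.perp := by
  refine P.perp_le_of_homogeneous (S := P.perp.comap dm) (fun i a ha hi => ?_) ha
  refine P.mem_perp_of_homogeneous fun j x hx => ?_
  have hB := hdm.2.2.2 i a hi
  obtain ⟨c, hc, h, hh, b, hb, rfl⟩ := hP.exists_decomp hx
  obtain ⟨c', hc', hcc⟩ := hP.exists_d_eq hc
  have hHB : P.intg (dm a * (h + b)) = 0 :=
    hP.intg_mul_eq_zero' (Submodule.add_mem_sup hh hb) hB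
  obtain ⟨h', hh', hb', hdec⟩ := hP.exists_harmonic hdm hi
  have hd : P.intg (P.d (dm a) * c') = 0 := by
    have h₁ := P.mem_perp.1 ha c'
    have h₂ := hP.intg_mul_eq_zero (Submodule.add_mem_sup hh' hb') hc'
    rw [hdec, add_assoc, add_mul, map_add, h₂, add_zero] at h₁
    exact h₁
  rw [P.intg_d_mul (hP.2.1 _ hB), neg_eq_zero] at hd
  have hexact : P.intg (dm a * P.d c') = 0 :=
    (mul_eq_zero.1 hd).resolve_left (zpow_ne_zero _ (neg_ne_zero.2 one_ne_zero))
  rw [add_assoc, mul_add, map_add, hHB, hcc, hexact, add_zero]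

/-- On the null space, the identity equals `d d⁻ + d⁻ d`. -/
theorem IsHodge.d_dm_add_dm_d (hP : P.IsHodge H B) (hdm : P.toDGA.IsDminus H B dm) {a : A}
    (ha : a ∈ P.perp) : P.d (dm a) + dm (P.d a) = a := by
  refine P.perp_le_of_homogeneous
    (S := LinearMap.eqLocus (P.d ∘ₗ dm + dm ∘ₗ P.d) LinearMap.id) (fun i a ha hi => ?_) ha
  obtain ⟨h, hh, -, hdec⟩ := hP.exists_harmonic hdm hi
  have hperp : h ∈ P.perp := by
    have : h = a - P.d (dm a) - dm (P.d a) := by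
      nth_rewrite 1 [hdec]
      abel
    rw [this]
    exact sub_mem (sub_mem ha (P.d_mem_perp (hP.dm_mem_perp hdm ha)))
      (hP.dm_mem_perp hdm (P.d_mem_perp ha))
  obtain ⟨c, hc⟩ := P.nondeg i h (hP.harmonic_mem_grading hh) (hP.d_harmonic hh)
    fun b _ _ => P.mem_perp.1 hperp b
  have h0 : h = 0 := by
    rw [hc, ← hP.d_dm_d hdm c, ← hc, hdm.2.1 i h hh, map_zero]
  rw [h0, add_zero] at hdec
  exact hdec.symm

end PoincareDGCA

/-- For a Poincaré DGCA of Hodge type, the null space `A⊥` of the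
induced pairing is a `d`-invariant ideal, invariant under `d⁻`, with
`A⊥ = d d⁻(A⊥) ⊕ d⁻ d(A⊥)`, and the complex `(A⊥, d)` has trivial cohomology; indeed
the identity of `A⊥` equals `d d⁻ + d⁻ d` there, so it is null-homotopic. -/
theorem statement_1 {F : Type u} {A : Type v} [Field F] [Ring A] [Algebra F A] {n : ℤ}
    (P : PoincareDGCA F A n) (H B : ℤ → Submodule F A) (hHodge : P.IsHodge H B)
    (dm : A →ₗ[F] A) (hdm : P.toDGA.IsDminus H B dm) :
    -- `A⊥` is an ideal
    (∀ a ∈ P.perp, ∀ x : A, x * a ∈ P.perp ∧ a * x ∈ P.perp) ∧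
    -- `A⊥` is `d`-invariant
    (∀ a ∈ P.perp, P.d a ∈ P.perp) ∧
    -- `A⊥` is `d⁻`-invariant
    (∀ a ∈ P.perp, dm a ∈ P.perp) ∧
    -- `A⊥ = d d⁻(A⊥) ⊕ d⁻ d(A⊥)`
    (Submodule.map (P.d ∘ₗ dm) P.perp ⊔ Submodule.map (dm ∘ₗ P.d) P.perp = P.perp) ∧
    Disjoint (Submodule.map (P.d ∘ₗ dm) P.perp) (Submodule.map (dm ∘ₗ P.d) P.perp) ∧
    -- the identity of `A⊥` is `d d⁻ + d⁻ d`, hence null-homotopic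
    (∀ a ∈ P.perp, P.d (dm a) + dm (P.d a) = a) ∧
    -- `(A⊥, d)` has trivial cohomology
    (∀ a ∈ P.perp, P.d a = 0 → ∃ b ∈ P.perp, a = P.d b) := by
  refine ⟨fun a ha x => ⟨P.mem_perp_mul ha x, P.mul_mem_perp ha x⟩, fun a => P.d_mem_perp,
    fun a => hHodge.dm_mem_perp hdm, le_antisymm (sup_le ?_ ?_) fun a ha => ?_, ?_,
    fun a => hHodge.d_dm_add_dm_d hdm, fun a ha h => ⟨dm a, hHodge.dm_mem_perp hdm ha, ?_⟩⟩
  · rintro _ ⟨a, ha, rfl⟩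
    exact P.d_mem_perp (hHodge.dm_mem_perp hdm ha)
  · rintro _ ⟨a, ha, rfl⟩
    exact hHodge.dm_mem_perp hdm (P.d_mem_perp ha)
  · rw [← hHodge.d_dm_add_dm_d hdm ha]
    exact Submodule.add_mem_sup ⟨a, ha, rfl⟩ ⟨a, ha, rfl⟩
  · rw [Submodule.disjoint_def]
    rintro _ ⟨a, ha, rfl⟩ ⟨b, -, hab⟩
    simp only [LinearMap.comp_apply] at hab ⊢
    rw [← hHodge.d_dm_add_dm_d hdm (P.d_mem_perp (hHodge.dm_mem_perp hdm ha)), P.d_d,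
      map_zero, add_zero, ← hab, PoincareDGCA.dm_dm hdm, map_zero]
  · simpa [h] using (hHodge.d_dm_add_dm_d hdm ha).symm
end

section
/- Let F be a field of characteristic 0 and let A* be the graded F-vector space with basis x_0, x_2, x_3, x_4 in degrees 0, 2, 3, 4 respectively (and A^k = 0 for all other k), with the unique DGCA structure determined by: x_0 is the unit, x_2·x_2 = x_4, all other products of x_2, x_3, x_4 vanish, d(x_2) = x_3, and d vanishes on x_0, x_3, x_4. Then H^4(A*) is spanned by [x_4], and with the linear functional ∫ : H^4(A*) → F determined by ∫[x_4] = 1, A* is a Poincaré DGCA of degree 4 which admits no Hodge type decomposition. -/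
universe u v

open scoped TensorProduct

/-- In a DGA concentrated in degrees `0, 2, 3, 4`, each spanned by one element, every
homogeneous element is a multiple of the corresponding spanning element. -/
theorem DGA.forall_exists_homogeneous_smul {F : Type u} {A : Type v} [Field F] [Ring A]
    [Algebra F A] (D : DGA F A) {x0 x2 x3 x4 : A}
    (h0 : D.grading 0 = Submodule.span F {x0})
    (h2 : D.grading 2 = Submodule.span F {x2})
    (h3 : D.grading 3 = Submodule.span F {x3})
    (h4 : D.grading 4 = Submodule.span F {x4})
    (hother : ∀ k : ℤ, k ≠ 0 → k ≠ 2 → k ≠ 3 → k ≠ 4 → D.grading k = ⊥)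
    (i : ℤ) (a : A) (ha : a ∈ D.grading i) :
    (i = 0 ∧ ∃ c : F, c • x0 = a) ∨ (i = 2 ∧ ∃ c : F, c • x2 = a) ∨
      (i = 3 ∧ ∃ c : F, c • x3 = a) ∨ (i = 4 ∧ ∃ c : F, c • x4 = a) ∨ a = 0 := by
  simp only [← Submodule.mem_span_singleton, ← h0, ← h2, ← h3, ← h4]
  by_cases k0 : i = 0
  · exact Or.inl ⟨k0, k0 ▸ ha⟩
  by_cases k2 : i = 2
  · exact Or.inr (Or.inl ⟨k2, k2 ▸ ha⟩)
  by_cases k3 : i = 3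
  · exact Or.inr (Or.inr (Or.inl ⟨k3, k3 ▸ ha⟩))
  by_cases k4 : i = 4
  · exact Or.inr (Or.inr (Or.inr (Or.inl ⟨k4, k4 ▸ ha⟩)))
  rw [hother i k0 k2 k3 k4] at ha
  simpa [k0, k2, k3, k4] using ha

/-- The DGCA on generators `x₀ = 1, x₂, x₃, x₄` in degrees `0, 2, 3, 4`
with `x₂·x₂ = x₄`, `d x₂ = x₃` (all other products and differentials vanishing) has
`H⁴` spanned by `[x₄]`; with `∫ [x₄] = 1` it is a Poincaré DGCA of degree `4`
admitting no Hodge type decomposition. -/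
theorem statement_3 {F : Type u} {A : Type v} [Field F] [Ring A] [Algebra F A]
    (D : DGCA F A) (x2 x3 x4 : A)
    (h0 : D.grading 0 = Submodule.span F {(1 : A)})
    (h2 : D.grading 2 = Submodule.span F {x2})
    (h3 : D.grading 3 = Submodule.span F {x3})
    (h4 : D.grading 4 = Submodule.span F {x4})
    (hother : ∀ k : ℤ, k ≠ 0 → k ≠ 2 → k ≠ 3 → k ≠ 4 → D.grading k = ⊥)
    (hx2 : x2 ≠ 0) (hx3 : x3 ≠ 0) (hx4 : x4 ≠ 0)
    (hmul : x2 * x2 = x4) (hd : D.d x2 = x3) :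
    -- `H⁴` is spanned by the class of `x₄` (no coboundaries in degree 4)
    D.toDGA.Bc 4 = ⊥ ∧ D.toDGA.Zc 4 = Submodule.span F {x4} ∧
    -- with `∫[x₄] = 1`, `A*` is a Poincaré DGCA of degree 4 …
    (∃ P : PoincareDGCA F A 4, P.toDGCA = D ∧ P.intg x4 = 1) ∧
    -- … admitting no Hodge type decomposition
    (∀ P : PoincareDGCA F A 4, P.toDGCA = D → ¬ P.HodgeType) := by
  have d1 : D.d 1 = 0 := by
    have h := D.d_mem D.one_mem
    rw [hother (0 + 1) (by norm_num) (by norm_num) (by norm_num) (by norm_num)] at h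
    simpa using h
  have d3 : D.d x3 = 0 := by rw [← hd]; exact D.d_d x2
  have m4 : x4 ∈ D.grading 4 := h4 ▸ Submodule.mem_span_singleton_self x4
  have m2 : x2 ∈ D.grading 2 := h2 ▸ Submodule.mem_span_singleton_self x2
  have m3 : x3 ∈ D.grading 3 := h3 ▸ Submodule.mem_span_singleton_self x3
  have d4 : D.d x4 = 0 := by
    have h := D.d_mem m4
    rw [hother (4 + 1) (by norm_num) (by norm_num) (by norm_num) (by norm_num)] at h
    simpa using h
  have key := D.forall_exists_homogeneous_smul h0 h2 h3 h4 hother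
  have range_d (a : A) : D.d a ∈ D.grading 3 := by
    have ha : a ∈ ⨆ i, D.grading i := by
      rw [D.internal.submodule_iSup_eq_top]; trivial
    induction ha using Submodule.iSup_induction' with
    | mem i a ha =>
      rcases key i a ha with ⟨-, c, rfl⟩ | ⟨-, c, rfl⟩ | ⟨-, c, rfl⟩ | ⟨-, c, rfl⟩ | rfl
      · simp [d1]
      · rw [map_smul, hd]; exact Submodule.smul_mem _ c m3
      · simp [d3]
      · simp [d4]
      · simp
    | zero => simp
    | add a b _ _ ha hb => rw [map_add]; exact add_mem ha hb
  have indep := D.internal.submodule_iSupIndep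
  refine ⟨?_, ?_, ?_, ?_⟩
  · rw [DGA.Bc, show (4 : ℤ) - 1 = 3 by norm_num, h3, Submodule.map_span]
    simp [d3]
  · rw [DGA.Zc, ← h4, inf_eq_left, h4, Submodule.span_le]
    simpa using d4
  · have hnot : x4 ∉ ⨆ j, ⨆ (_ : j ≠ 4), D.grading j := fun h =>
      hx4 (Submodule.disjoint_def.mp (indep 4) x4 m4 h)
    obtain ⟨f, hf, hker⟩ := Submodule.exists_le_ker_of_notMem hnot
    have fdeg (i : ℤ) (hi : i ≠ 4) (a : A) (ha : a ∈ D.grading i) : f a = 0 :=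
      hker (Submodule.mem_iSup_of_mem i (Submodule.mem_iSup_of_mem hi ha))
    refine ⟨{ D with
      top := fun i hi => hother i (by lia) (by lia) (by lia) (by lia)
      fin_cohomology := fun k => ⟨D.grading k, ?_, fun a ha _ => ⟨a, ha, 0, by simp⟩⟩
      intg := (f x4)⁻¹ • f
      intg_deg := fun i hi a ha => by simp [fdeg i hi a ha]
      intg_d := fun a => by simp [fdeg 3 (by norm_num) _ (range_d a)]
      nondeg := ?_ }, rfl, by simp [hf]⟩
    · by_cases k0 : k = 0
      · subst k0; rw [h0]; infer_instance
      by_cases k2 : k = 2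
      · subst k2; rw [h2]; infer_instance
      by_cases k3 : k = 3
      · subst k3; rw [h3]; infer_instance
      by_cases k4 : k = 4
      · subst k4; rw [h4]; infer_instance
      rw [hother k k0 k2 k3 k4]; infer_instance
    · intro i a ha hda hpair
      rcases key i a ha with ⟨rfl, c, rfl⟩ | ⟨rfl, c, rfl⟩ | ⟨rfl, c, rfl⟩ | ⟨rfl, c, rfl⟩ | rfl
      · have h := hpair x4 (by simpa using m4) d4
        have hc : c = 0 := by simpa [hf] using h
        exact ⟨0, by simp [hc]⟩
      · have hc : c = 0 := by simpa [hd, hx3] using hda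
        exact ⟨0, by simp [hc]⟩
      · exact ⟨c • x2, by rw [map_smul, hd]⟩
      · have h := hpair 1 (by simpa using D.one_mem) d1
        have hc : c = 0 := by simpa [hf] using h
        exact ⟨0, by simp [hc]⟩
      · exact ⟨0, by simp⟩
  · rintro P rfl ⟨H, B, hH, hB, -, hspan, horth⟩
    have hBc : P.toDGA.Bc 2 = ⊥ := by
      rw [DGA.Bc, hother (2 - 1) (by norm_num) (by norm_num) (by norm_num) (by norm_num),
        Submodule.map_bot]
    have hH2 : H 2 = ⊥ := by
      rw [eq_bot_iff]
      intro a ha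
      obtain ⟨ha2, hda⟩ := (hH 2).1 ha
      rw [SetLike.mem_coe, h2, Submodule.mem_span_singleton] at ha2
      obtain ⟨c, rfl⟩ := ha2
      have hc : c = 0 := by simpa [hd, hx3] using hda
      simp [hc]
    have hx2B : x2 ∈ B 2 := by simpa [hBc, hH2] using hspan 2 m2
    have hint : P.intg x4 = 0 := hmul ▸ horth 2 2 x2 (Submodule.mem_sup_right hx2B) x2 hx2B
    obtain ⟨c, hc⟩ := P.nondeg 4 x4 m4 d4 fun b hb _ => by
      rw [sub_self, h0, Submodule.mem_span_singleton] at hb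
      obtain ⟨c, rfl⟩ := hb
      simp [hint]
    exact hx4 (Submodule.disjoint_def.mp (indep.pairwiseDisjoint (by norm_num : (4 : ℤ) ≠ 3))
      x4 m4 (hc ▸ range_d c))
end

section
/- Let A* be an associative, unital, not necessarily commutative differential graded algebra over a field F of characteristic 0, with A^k = 0 for k < 0 and for k > n, such that H^0(A*) = F·[1], H^1(A*) = 0, and dim_F H^k(A*) < ∞ for all k. Then there exists a finite-dimensional differential graded subalgebra C* ⊆ A* such that the inclusion C* ↪ A* is a quasi-isomorphism. -/
universe u v

open scoped TensorProduct

namespace DGA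

variable {F : Type u} {A : Type v} [Field F] [Ring A] [Algebra F A]

theorem exists_homogeneous_primitive (D : DGA F A) {i : ℤ} {x : A}
    (hx : x ∈ D.grading (i + 1)) (hex : D.IsExact x) : ∃ y ∈ D.grading i, x = D.d y := by
  classical
  let := D.internal.chooseDecomposition
  have key : ∀ b : A, ((DirectSum.decompose D.grading (D.d b) (i + 1) : D.grading (i + 1)) : A) =
      D.d (DirectSum.decompose D.grading b i : D.grading i) := by
    intro b
    induction b using DirectSum.Decomposition.inductionOn D.grading with
    | zero => simp
    | @homogeneous j m =>
      by_cases hij : j = i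
      · subst hij
        rw [DirectSum.decompose_of_mem_same _ (D.d_mem m.2),
          DirectSum.decompose_of_mem_same _ m.2]
      · rw [DirectSum.decompose_of_mem_ne _ (D.d_mem m.2) (by omega),
          DirectSum.decompose_of_mem_ne _ m.2 hij, map_zero]
    | add a b ha hb => simp [ha, hb]
  obtain ⟨b, rfl⟩ := hex
  refine ⟨_, (DirectSum.decompose D.grading b i).2, ?_⟩
  rw [← key, DirectSum.decompose_of_mem_same _ hx]

/-- The span in degree `k` of the products of two elements of `C` of degrees at least `2`. -/
def decomposables (C : ℕ → Submodule F A) (k : ℕ) : Submodule F A :=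
  ⨆ p ∈ (Finset.HasAntidiagonal.antidiagonal k).filter (fun p => 2 ≤ p.1 ∧ 2 ≤ p.2), C p.1 * C p.2

theorem mul_mem_decomposables {C : ℕ → Submodule F A} {i j k : ℕ} (hi : 2 ≤ i) (hj : 2 ≤ j)
    (hk : i + j = k) {a b : A} (ha : a ∈ C i) (hb : b ∈ C j) : a * b ∈ decomposables C k := by
  have hp : (i, j) ∈ (Finset.HasAntidiagonal.antidiagonal k).filter (fun p => 2 ≤ p.1 ∧ 2 ≤ p.2) := by
    simp [hi, hj, hk]
  exact (le_biSup (fun p : ℕ × ℕ => C p.1 * C p.2) hp) (Submodule.mul_mem_mul ha hb)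

theorem decomposables_le {C : ℕ → Submodule F A} {k : ℕ} {S : Submodule F A}
    (h : ∀ i j, 2 ≤ i → 2 ≤ j → i + j = k → ∀ a ∈ C i, ∀ b ∈ C j, a * b ∈ S) :
    decomposables C k ≤ S := by
  refine iSup₂_le fun p hp => Submodule.mul_le.2 ?_
  simp only [Finset.mem_filter, Finset.HasAntidiagonal.mem_antidiagonal] at hp
  exact h _ _ hp.2.1 hp.2.2 hp.1

theorem decomposables_congr {C C' : ℕ → Submodule F A} {k : ℕ}
    (h : ∀ i, i + 2 ≤ k → C i = C' i) : decomposables C k = decomposables C' k := by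
  refine biSup_congr fun p hp => ?_
  simp only [Finset.mem_filter, Finset.HasAntidiagonal.mem_antidiagonal] at hp
  rw [h p.1 (by omega), h p.2 (by omega)]

theorem fg_decomposables {C : ℕ → Submodule F A} (h : ∀ k, (C k).FG) (k : ℕ) :
    (decomposables C k).FG :=
  Submodule.fg_biSup _ _ fun p _ => (h p.1).mul (h p.2)

theorem decomposables_le_grading (D : DGA F A) {C : ℕ → Submodule F A}
    (h : ∀ k : ℕ, C k ≤ D.grading k) (k : ℕ) : decomposables C k ≤ D.grading k := by
  refine decomposables_le fun i j _ _ hk a ha b hb => ?_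
  subst hk
  push_cast
  exact D.mul_mem (h i ha) (h j hb)

/-- The conditions on the degree `k` part of a small model, relative to lower degrees. -/
structure IsModelAt (D : DGA F A) (C : ℕ → Submodule F A) (k : ℕ) : Prop where
  decomposables_le : decomposables C k ≤ C k
  d_mem : ∀ x ∈ C k, D.d x ∈ decomposables C (k + 1)
  exists_primitive : ∀ x ∈ decomposables C (k + 1), D.IsExact x → ∃ y ∈ C k, x = D.d y
  exists_cohomologous : ∀ z ∈ D.grading k, D.d z = 0 → ∃ c ∈ C k, D.IsExact (z - c)
  mem_of_isExact : ∀ x ∈ C k, D.IsExact x → x ∈ decomposables C k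

theorem IsModelAt.congr {D : DGA F A} {C C' : ℕ → Submodule F A} {k : ℕ}
    (hC : D.IsModelAt C k) (h : ∀ i ≤ k, C i = C' i) : D.IsModelAt C' k := by
  have h0 : decomposables C k = decomposables C' k :=
    decomposables_congr fun i hi => h i (by omega)
  have h1 : decomposables C (k + 1) = decomposables C' (k + 1) :=
    decomposables_congr fun i hi => h i (by omega)
  obtain ⟨a, b, c, d, e⟩ := hC
  rw [h k le_rfl] at *
  rw [h0] at *
  rw [h1] at *
  exact ⟨a, b, c, d, e⟩

theorem exists_relative_complement {B P M : Submodule F A} (hB : B ≤ M) (hP : P ≤ M) :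
    ∃ X : Submodule F A, P ≤ X ∧ X ≤ M ∧ M ≤ X ⊔ B ∧ X ⊓ B ≤ P := by
  obtain ⟨Y, hY⟩ := exists_isCompl (B ⊔ P)
  refine ⟨P ⊔ Y ⊓ M, le_sup_left, sup_le hP inf_le_right, ?_, ?_⟩
  · have : M = (B ⊔ P) ⊔ Y ⊓ M := by
      rw [← sup_inf_assoc_of_le _ (sup_le hB hP), hY.sup_eq_top, top_inf_eq]
    rw [this]
    refine sup_le (sup_le le_sup_right (le_sup_left.trans le_sup_left)) ?_
    rw [← this]
    exact le_sup_right.trans le_sup_left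
  · calc (P ⊔ Y ⊓ M) ⊓ B ≤ (P ⊔ Y) ⊓ (B ⊔ P) :=
        inf_le_inf (sup_le_sup_left inf_le_left _) le_sup_left
      _ = P ⊔ Y ⊓ (B ⊔ P) := sup_inf_assoc_of_le _ le_sup_right
      _ = P := by rw [inf_comm Y, hY.inf_eq_bot, sup_bot_eq]

theorem exists_extension (D : DGA F A)
    (hfin : ∀ k : ℤ, ∃ W : Submodule F A, FiniteDimensional F W ∧
      ∀ a ∈ D.grading k, D.d a = 0 → ∃ w ∈ W, ∃ c, a - w = D.d c)
    {P Q : Submodule F A} {k : ℕ} (hP : P ≤ D.grading k) (hQ : Q ≤ D.grading (k + 1))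
    (hPfg : P.FG) (hQfg : Q.FG) (hPQ : ∀ x ∈ P, D.d x ∈ Q) :
    ∃ X : Submodule F A, X ≤ D.grading k ∧ X.FG ∧ P ≤ X ∧ (∀ x ∈ X, D.d x ∈ Q) ∧
      (∀ x ∈ Q, D.IsExact x → ∃ y ∈ X, x = D.d y) ∧
      (∀ z ∈ D.grading k, D.d z = 0 → ∃ c ∈ X, D.IsExact (z - c)) ∧
      (∀ x ∈ X, D.IsExact x → x ∈ P) := by
  obtain ⟨X, hPX, hXM, hMX, hXB⟩ := exists_relative_complement
    (B := D.grading k ⊓ LinearMap.range D.d) (P := P) (M := D.grading k ⊓ Q.comap D.d)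
    (by
      rintro _ ⟨h, y, rfl⟩
      refine ⟨h, ?_⟩
      simp [D.d_d])
    (fun x hx => ⟨hP hx, hPQ x hx⟩)
  have hXg : X ≤ D.grading k := hXM.trans inf_le_left
  refine ⟨X, hXg, ?_, hPX, fun x hx => (hXM hx).2, ?_, ?_, ?_⟩
  · refine Submodule.fg_of_fg_map_of_fg_inf_ker D.d ?_ ?_
    · have : FiniteDimensional F Q := Module.Finite.iff_fg.2 hQfg
      have hle : X.map D.d ≤ Q := by
        rintro _ ⟨x, hx, rfl⟩
        exact (hXM hx).2
      exact Module.Finite.iff_fg.1 (Submodule.finiteDimensional_of_le hle)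
    · obtain ⟨W, hW, hWk⟩ := hfin k
      refine Submodule.fg_of_fg_map_of_fg_inf_ker (LinearMap.range D.d).mkQ ?_ ?_
      · have : FiniteDimensional F (W.map (LinearMap.range D.d).mkQ) := inferInstance
        have hle : (X ⊓ LinearMap.ker D.d).map (LinearMap.range D.d).mkQ ≤
            W.map (LinearMap.range D.d).mkQ := by
          rintro _ ⟨x, ⟨hx, hx0⟩, rfl⟩
          obtain ⟨w, hw, c, hc⟩ := hWk x (hXg hx) hx0
          refine ⟨w, hw, ?_⟩
          symm
          rw [← sub_eq_zero, ← map_sub, hc]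
          simp
        exact Module.Finite.iff_fg.1 (Submodule.finiteDimensional_of_le hle)
      · have : FiniteDimensional F P := Module.Finite.iff_fg.2 hPfg
        have hle : X ⊓ LinearMap.ker D.d ⊓ LinearMap.ker (LinearMap.range D.d).mkQ ≤ P := by
          rintro x ⟨⟨hx, -⟩, hx'⟩
          rw [Submodule.ker_mkQ] at hx'
          exact hXB ⟨hx, hXg hx, hx'⟩
        exact Module.Finite.iff_fg.1 (Submodule.finiteDimensional_of_le hle)
  · intro x hx hex
    obtain ⟨y, hy, rfl⟩ := D.exists_homogeneous_primitive (hQ hx) hex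
    obtain ⟨c, hc, b, ⟨-, e, rfl⟩, rfl⟩ := Submodule.mem_sup.1 (hMX ⟨hy, hx⟩)
    exact ⟨c, hc, by simp [D.d_d]⟩
  · intro z hz hz0
    obtain ⟨c, hc, b, ⟨-, e, rfl⟩, rfl⟩ := Submodule.mem_sup.1
      (hMX ⟨hz, by simp [hz0]⟩)
    exact ⟨c, hc, e, by simp⟩
  · rintro x hx ⟨y, rfl⟩
    exact hXB ⟨hx, hXg hx, y, rfl⟩

theorem exists_isModelAt_lt (D : DGA F A)
    (hfin : ∀ k : ℤ, ∃ W : Submodule F A, FiniteDimensional F W ∧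
      ∀ a ∈ D.grading k, D.d a = 0 → ∃ w ∈ W, ∃ c, a - w = D.d c) (N : ℕ) :
    ∃ C : ℕ → Submodule F A, C 0 = 1 ∧ C 1 = ⊥ ∧ (∀ k : ℕ, C k ≤ D.grading k) ∧
      (∀ k, (C k).FG) ∧ ∀ k, 2 ≤ k → k < N → D.IsModelAt C k := by
  induction N with
  | zero =>
    refine ⟨Function.update ⊥ 0 1, by simp, by simp, fun k => ?_, fun k => ?_,
      fun k _ h => absurd h (by omega)⟩
    · rcases k with _ | k
      · simpa [Submodule.one_le] using D.one_mem
      · simp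
    · rcases k with _ | k
      · simpa [Submodule.one_eq_span] using Submodule.fg_span_singleton (1 : A)
      · simpa using Submodule.fg_bot
  | succ N ih =>
    obtain ⟨C, h0, h1, hg, hfg, hC⟩ := ih
    by_cases hN : N < 2
    · exact ⟨C, h0, h1, hg, hfg, fun k hk hk' => by omega⟩
    obtain ⟨X, hXg, hXfg, hX⟩ := D.exists_extension hfin (k := N)
      (D.decomposables_le_grading hg N)
      (by simpa using D.decomposables_le_grading hg (N + 1))
      (fg_decomposables hfg N) (fg_decomposables hfg (N + 1)) (by
        suffices decomposables C N ≤ (decomposables C (N + 1)).comap D.d from this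
        refine decomposables_le fun i j hi hj hk a ha b hb => ?_
        have hia := (hC (i + 1) (by omega) (by omega)).decomposables_le
          ((hC i hi (by omega)).d_mem a ha)
        have hjb := (hC (j + 1) (by omega) (by omega)).decomposables_le
          ((hC j hj (by omega)).d_mem b hb)
        rw [Submodule.mem_comap, D.leibniz a b (hg i ha)]
        exact add_mem (mul_mem_decomposables (by omega) hj (by omega) hia hb)
          (Submodule.smul_mem _ _ (mul_mem_decomposables hi (by omega) (by omega) ha hjb)))
    have hne : ∀ i, i < N → C i = Function.update C N X i := fun i hi => by
      rw [Function.update_of_ne (by omega)]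
    refine ⟨Function.update C N X, by rw [← hne 0 (by omega), h0],
      by rw [← hne 1 (by omega), h1], fun k => ?_, fun k => ?_, fun k hk hkN => ?_⟩
    · rcases eq_or_ne k N with rfl | h
      · simpa using hXg
      · simpa [h] using hg k
    · rcases eq_or_ne k N with rfl | h
      · simpa using hXfg
      · simpa [h] using hfg k
    · rcases eq_or_ne k N with rfl | h
      · rw [decomposables_congr fun i hi => hne i (by omega),
          decomposables_congr (k := k + 1) fun i hi => hne i (by omega)] at hX
        obtain ⟨a, b, c, d, e⟩ := hX
        exact ⟨by simpa using a, by simpa using b, by simpa using c, by simpa using d,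
          by simpa using e⟩
      · exact (hC k hk (by omega)).congr fun i hi => hne i (by omega)

theorem exists_isModelAt (D : DGA F A) (n : ℤ) (htop : ∀ i : ℤ, n < i → D.grading i = ⊥)
    (hfin : ∀ k : ℤ, ∃ W : Submodule F A, FiniteDimensional F W ∧
      ∀ a ∈ D.grading k, D.d a = 0 → ∃ w ∈ W, ∃ c, a - w = D.d c) :
    ∃ C : ℕ → Submodule F A, C 0 = 1 ∧ C 1 = ⊥ ∧ (∀ k : ℕ, C k ≤ D.grading k) ∧
      (∀ k, (C k).FG) ∧ ∀ k, 2 ≤ k → D.IsModelAt C k := by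
  obtain ⟨C, h0, h1, hg, hfg, hC⟩ := D.exists_isModelAt_lt hfin (n.toNat + 1)
  refine ⟨C, h0, h1, hg, hfg, fun k hk => ?_⟩
  by_cases hkn : k < n.toNat + 1
  · exact hC k hk hkn
  have hbot : ∀ j : ℕ, k ≤ j → D.grading j = ⊥ := fun j hj => htop _ (by omega)
  have hCk : C k = ⊥ := le_bot_iff.1 ((hg k).trans (hbot k le_rfl).le)
  have hdec : ∀ j, k ≤ j → decomposables C j = ⊥ := fun j hj =>
    le_bot_iff.1 ((D.decomposables_le_grading hg j).trans (hbot j hj).le)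
  constructor <;> simp [hCk, hdec, hbot, IsExact]
  exact ⟨0, by simp⟩

/-- The subalgebra spanned by a multiplicative family of subspaces. -/
def subalgebraOfFamily (C : ℕ → Submodule F A) (h1 : (1 : A) ∈ C 0)
    (hmul : ∀ i j, C i * C j ≤ C (i + j)) : Subalgebra F A :=
  (⨆ k, C k).toSubalgebra (Submodule.mem_iSup_of_mem 0 h1) (by
    suffices (⨆ k, C k) * (⨆ k, C k) ≤ ⨆ k, C k from
      fun x y hx hy => this (Submodule.mul_mem_mul hx hy)
    simp only [Submodule.iSup_mul, Submodule.mul_iSup]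
    exact iSup₂_le fun i j => (hmul _ _).trans (le_iSup C _))

theorem iSup_inf_grading_le (D : DGA F A) {C : ℕ → Submodule F A}
    (hg : ∀ k : ℕ, C k ≤ D.grading k) (k : ℕ) : (⨆ j, C j) ⊓ D.grading k ≤ C k := by
  classical
  let := D.internal.chooseDecomposition
  have key : ∀ x ∈ ⨆ j, C j,
      ((DirectSum.decompose D.grading x k : D.grading k) : A) ∈ C k := by
    intro x hx
    induction hx using Submodule.iSup_induction' with
    | mem j x hx =>
      rcases eq_or_ne j k with rfl | h
      · rwa [DirectSum.decompose_of_mem_same _ (hg _ hx)]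
      · rw [DirectSum.decompose_of_mem_ne _ (hg _ hx) (by exact_mod_cast h)]
        exact zero_mem _
    | zero => simp
    | add x y _ _ hx hy => simpa using add_mem hx hy
  rintro x ⟨hx, hxk⟩
  simpa [DirectSum.decompose_of_mem_same _ hxk] using key x hx

end DGA

/-- A (not necessarily commutative) DGA over a field of characteristic
zero, concentrated in degrees `0, …, n`, with `H⁰ = F·[1]`, `H¹ = 0` and finite
dimensional cohomology, admits a finite dimensional differential graded subalgebra
whose inclusion is a quasi-isomorphism. -/
theorem statement_5 {F : Type u} {A : Type v} [Field F] [Ring A] [Algebra F A]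
    (D : DGA F A) (n : ℤ)
    (htop : ∀ i : ℤ, n < i → D.grading i = ⊥)
    (hconn : D.Connected)
    (hH1 : ∀ a ∈ D.grading 1, D.d a = 0 → D.IsExact a)
    (hfin : ∀ k : ℤ, ∃ W : Submodule F A, FiniteDimensional F W ∧
      ∀ a ∈ D.grading k, D.d a = 0 → ∃ w ∈ W, ∃ c, a - w = D.d c) :
    ∃ C : Subalgebra F A,
      FiniteDimensional F C ∧
      -- `C` is a graded subspace, closed under `d`
      (Subalgebra.toSubmodule C =
        ⨆ i : ℤ, Subalgebra.toSubmodule C ⊓ D.grading i) ∧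
      (∀ a ∈ C, D.d a ∈ C) ∧
      -- the inclusion `C ↪ A` is injective on cohomology …
      (∀ i : ℤ, ∀ c ∈ Subalgebra.toSubmodule C ⊓ D.grading i, D.d c = 0 →
        D.IsExact c → ∃ b ∈ C, c = D.d b) ∧
      -- … and surjective on cohomology
      (∀ i : ℤ, ∀ a ∈ D.grading i, D.d a = 0 →
        ∃ c ∈ Subalgebra.toSubmodule C ⊓ D.grading i, D.d c = 0 ∧
          ∃ b, a - c = D.d b) := by
  obtain ⟨C, h0, h1, hg, hfg, hC⟩ := D.exists_isModelAt n htop hfin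
  have hmul : ∀ i j, C i * C j ≤ C (i + j) := by
    intro i j
    rcases (by omega : i = 0 ∨ j = 0 ∨ i = 1 ∨ j = 1 ∨ (2 ≤ i ∧ 2 ≤ j)) with
      rfl | rfl | rfl | rfl | ⟨hi, hj⟩
    · simp [h0]
    · simp [h0]
    · simp [h1]
    · simp [h1]
    · exact Submodule.mul_le.2 fun a ha b hb =>
        (hC (i + j) (by omega)).decomposables_le (DGA.mul_mem_decomposables hi hj rfl ha hb)
  have hone : (1 : A) ∈ C 0 := by rw [h0]; exact Submodule.one_le.1 le_rfl
  have hd1 : D.d 1 = 0 := by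
    have := D.leibniz 1 1 D.one_mem
    simpa using this
  have hd : ∀ k, ∀ x ∈ C k, D.d x ∈ C (k + 1) := by
    intro k x hx
    rcases (by omega : k = 0 ∨ k = 1 ∨ 2 ≤ k) with rfl | rfl | hk
    · rw [h0, Submodule.mem_one] at hx
      obtain ⟨c, rfl⟩ := hx
      simp [Algebra.algebraMap_eq_smul_one, hd1]
    · rw [h1, Submodule.mem_bot] at hx
      simp [hx]
    · exact (hC (k + 1) (by omega)).decomposables_le ((hC k hk).d_mem x hx)
  have hmem : ∀ x, x ∈ DGA.subalgebraOfFamily C hone hmul ↔ x ∈ ⨆ k, C k := fun _ => Iff.rfl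
  have hsub : Subalgebra.toSubmodule (DGA.subalgebraOfFamily C hone hmul) = ⨆ k, C k := rfl
  have hle : ∀ k, C k ≤ ⨆ k, C k := le_iSup C
  refine ⟨DGA.subalgebraOfFamily C hone hmul, ?_, ?_, ?_, ?_, ?_⟩
  · have hfin' : (⨆ k ∈ Finset.range (n.toNat + 1), C k).FG :=
      Submodule.fg_biSup _ _ fun k _ => hfg k
    have : (⨆ k, C k) ≤ ⨆ k ∈ Finset.range (n.toNat + 1), C k := by
      refine iSup_le fun k => ?_
      by_cases hk : k ∈ Finset.range (n.toNat + 1)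
      · exact le_biSup C hk
      · rw [Finset.mem_range] at hk
        exact ((hg k).trans (htop k (by omega)).le).trans bot_le
    have : FiniteDimensional F (⨆ k ∈ Finset.range (n.toNat + 1), C k : Submodule F A) :=
      Module.Finite.iff_fg.2 hfin'
    exact Submodule.finiteDimensional_of_le (S₁ := ⨆ k, C k) ‹_›
  · rw [hsub]
    refine le_antisymm (iSup_le fun k => ?_) (iSup_le fun i => inf_le_left)
    exact (le_inf (hle k) (hg k)).trans
      (le_iSup (fun i : ℤ => (⨆ k, C k) ⊓ D.grading i) (k : ℤ))
  · intro a ha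
    rw [hmem] at ha ⊢
    suffices (⨆ k, C k) ≤ (⨆ k, C k).comap D.d from this ha
    exact iSup_le fun k x hx => hle (k + 1) (hd k x hx)
  · rintro i c ⟨hc, hci⟩ - hex
    rcases lt_or_ge i 0 with hi | hi
    · rw [D.nonneg i hi, SetLike.mem_coe, Submodule.mem_bot] at hci
      exact ⟨0, zero_mem _, by simp [hci]⟩
    lift i to ℕ using hi
    have hcC : c ∈ C i := D.iSup_inf_grading_le hg i ⟨hc, hci⟩
    rcases (by omega : i = 0 ∨ i = 1 ∨ 2 ≤ i) with rfl | rfl | hi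
    · obtain ⟨y, hy, rfl⟩ := D.exists_homogeneous_primitive (i := -1) (by simpa using hci) hex
      rw [D.nonneg _ (by omega), Submodule.mem_bot] at hy
      exact ⟨0, zero_mem _, by simp [hy]⟩
    · rw [h1, Submodule.mem_bot] at hcC
      exact ⟨0, zero_mem _, by simp [hcC]⟩
    · have hcP := (hC i hi).mem_of_isExact c hcC hex
      rcases hi.eq_or_lt with rfl | hi
      · have : DGA.decomposables C 2 ≤ ⊥ :=
          DGA.decomposables_le fun i j _ _ _ => by omega
        have hc0 : c = 0 := (Submodule.mem_bot F).1 (this hcP)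
        exact ⟨0, zero_mem _, by simp [hc0]⟩
      · obtain ⟨k, rfl⟩ := Nat.exists_eq_add_of_lt hi
        obtain ⟨y, hy, rfl⟩ := (hC (2 + k) (by omega)).exists_primitive c hcP hex
        exact ⟨y, hle _ hy, rfl⟩
  · intro i a ha ha0
    suffices ∃ c, ∃ k : ℕ, c ∈ C k ∧ c ∈ D.grading i ∧ D.IsExact (a - c) by
      obtain ⟨c, k, hck, hci, b, hb⟩ := this
      refine ⟨c, ⟨hle k hck, hci⟩, ?_, b, hb⟩
      have := congrArg D.d hb
      simpa [D.d_d, ha0] using this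
    rcases lt_or_ge i 0 with hi | hi
    · rw [D.nonneg i hi, Submodule.mem_bot] at ha
      exact ⟨0, 0, zero_mem _, zero_mem _, 0, by simp [ha]⟩
    lift i to ℕ using hi
    rcases (by omega : i = 0 ∨ i = 1 ∨ 2 ≤ i) with rfl | rfl | hi
    · obtain ⟨c, rfl⟩ := hconn a (by simpa using ha) ha0
      exact ⟨_, 0, Submodule.smul_mem _ c hone, ha, 0, by simp⟩
    · exact ⟨0, 0, zero_mem _, zero_mem _, by simpa using hH1 a (by simpa using ha) ha0⟩
    · obtain ⟨c, hc, hex⟩ := (hC i hi).exists_cohomologous a ha ha0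
      exact ⟨c, i, hc, hg i hc, hex⟩
end

section
/- Let A* be a connected Poincaré DGCA of degree n, let H*_gen be a generating subspace and ι0 : H*_gen → A*_d a partial splitting map. Then there exists a linear splitting ι : H*(A*) → A*_d of the quotient map pr : A*_d → H*(A*) (i.e. pr∘ι = id) such that ι restricted to H*_gen equals ι0 and the image ι(H*(A*)) is contained in the subalgebra of A*_d generated by ι0(H*_gen). In other words, an ι0-adapted harmonic subspace always exists. Moreover, such splittings ι are in one-to-one correspondence with linear splittings of the surjection pr : ι0(S*_{≥2}) → H*_+·H*_+, where ι0(S*_{≥2}) denotes the linear span of all products of at least two elements of ι0(H*_gen). -/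
universe u v

open scoped TensorProduct

variable {F : Type u} {A : Type v} [Field F] [Ring A] [Algebra F A]

/-- The span, in degree `k`, of products of two positive-degree cocycles; its image in
cohomology is `H⁺·H⁺` in degree `k`. -/
def posProdSpan (D : DGA F A) (k : ℤ) : Submodule F A :=
  Submodule.span F {x : A | ∃ i j : ℤ, 1 ≤ i ∧ 1 ≤ j ∧ i + j = k ∧
    ∃ a ∈ D.Zc i, ∃ b ∈ D.Zc j, x = a * b}

/-- A graded family `G` of cocycles representing (via `ι₀`) a generating subspace
`H*_gen ⊆ H*₊` together with a partial splitting map: the classes of `G` form a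
complement of `H*₊ · H*₊` in `H*₊`. -/
def IsGeneratingFamily (D : DGA F A) (G : ℤ → Submodule F A) : Prop :=
  (∀ k : ℤ, G k ≤ D.Zc k) ∧
  (∀ k : ℤ, k ≤ 0 → G k = ⊥) ∧
  (∀ k : ℤ, Disjoint (G k) (posProdSpan D k ⊔ D.Bc k)) ∧
  (∀ k : ℤ, 1 ≤ k → D.Zc k ≤ G k ⊔ posProdSpan D k ⊔ D.Bc k)

/-- The harmonic subspace `H'` is `ι₀`-adapted: it is the image of a splitting of
`pr : A*_d → H*(A*)` extending `ι₀` whose image is contained in the subalgebra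
generated by `ι₀(H*_gen)` (here `G` plays the role of `ι₀(H*_gen)`). -/
def IsAdaptedHarmonic (D : DGA F A) (G H' : ℤ → Submodule F A) : Prop :=
  D.IsHarmonicFamily H' ∧ (∀ k : ℤ, G k ≤ H' k) ∧
  (∀ k : ℤ, H' k ≤ Subalgebra.toSubmodule (Algebra.adjoin F {a : A | ∃ j : ℤ, a ∈ G j}))

/-- `ι₀(S*_{≥2})`: the span of all products of at least two elements of
`ι₀(H*_gen)` (i.e. of `G`). -/
def prodSpan2 (G : ℤ → Submodule F A) : Submodule F A :=
  Submodule.span F {a : A | ∃ l : List A, 2 ≤ l.length ∧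
    (∀ x ∈ l, ∃ j : ℤ, x ∈ G j) ∧ a = l.prod}

/-- A splitting of the graded surjection `pr : ι₀(S*_{≥2}) → H*₊·H*₊`, encoded by its
image: a graded subspace `L` of cocycles of `ι₀(S*_{≥2})` mapping isomorphically onto
`H*₊·H*₊` in cohomology. -/
def IsSplittingFamily (D : DGA F A) (G L : ℤ → Submodule F A) : Prop :=
  ∀ k : ℤ, L k ≤ prodSpan2 G ⊓ D.Zc k ∧ Disjoint (L k) (D.Bc k) ∧
    prodSpan2 G ⊓ D.Zc k ≤ L k ⊔ D.Bc k

namespace DGA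

/-- The projection onto the homogeneous component of degree `k`. -/
lemma exists_proj (D : DGA F A) (k : ℤ) : ∃ p : A →ₗ[F] A,
    (∀ a ∈ D.grading k, p a = a) ∧ ∀ j : ℤ, j ≠ k → ∀ a ∈ D.grading j, p a = 0 := by
  classical
  let _ := D.internal.chooseDecomposition
  refine ⟨(D.grading k).subtype ∘ₗ DirectSum.component F ℤ (fun i => D.grading i) k ∘ₗ
    (DirectSum.decomposeLinearEquiv D.grading).toLinearMap, ?_, ?_⟩
  · intro a ha
    exact DirectSum.decompose_of_mem_same D.grading ha
  · intro j hj a ha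
    exact DirectSum.decompose_of_mem_ne D.grading ha hj

lemma mul_mem_Zc (D : DGA F A) {i j : ℤ} {a b : A} (ha : a ∈ D.Zc i) (hb : b ∈ D.Zc j) :
    a * b ∈ D.Zc (i + j) := by
  obtain ⟨ha, ha'⟩ := ha
  obtain ⟨hb, hb'⟩ := hb
  rw [SetLike.mem_coe, LinearMap.mem_ker] at ha' hb'
  refine ⟨D.mul_mem ha hb, ?_⟩
  rw [SetLike.mem_coe, LinearMap.mem_ker, D.leibniz a b ha, ha', hb']
  simp

lemma Bc_le_Zc (D : DGA F A) (k : ℤ) : D.Bc k ≤ D.Zc k := by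
  rintro _ ⟨e, he, rfl⟩
  have h := D.d_mem he
  rw [sub_add_cancel] at h
  exact ⟨h, D.d_d e⟩

lemma Bc_mul_mem (D : DGA F A) {i j : ℤ} {a b : A} (ha : a ∈ D.Bc i) (hb : b ∈ D.Zc j) :
    a * b ∈ D.Bc (i + j) := by
  obtain ⟨e, he, rfl⟩ := ha
  obtain ⟨hb, hb'⟩ := hb
  rw [SetLike.mem_coe, LinearMap.mem_ker] at hb'
  refine ⟨e * b, ?_, ?_⟩
  · have h := D.mul_mem he hb
    rwa [show i - 1 + j = i + j - 1 by ring] at h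
  · rw [D.leibniz e b he, hb']
    simp

lemma mul_Bc_mem (D : DGA F A) {i j : ℤ} {a b : A} (ha : a ∈ D.Zc i) (hb : b ∈ D.Bc j) :
    a * b ∈ D.Bc (i + j) := by
  obtain ⟨e, he, rfl⟩ := hb
  obtain ⟨ha, ha'⟩ := ha
  rw [SetLike.mem_coe, LinearMap.mem_ker] at ha'
  have hmem : D.d (a * e) ∈ D.Bc (i + j) := by
    have h := D.mul_mem ha he
    rw [show i + (j - 1) = i + j - 1 by ring] at h
    exact ⟨a * e, h, rfl⟩
  rw [D.leibniz a e ha, ha', zero_mul, zero_add] at hmem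
  exact (Submodule.smul_mem_iff _ (zpow_ne_zero i (by simp))).1 hmem

lemma Zc_eq_bot_of_neg (D : DGA F A) {k : ℤ} (hk : k < 0) : D.Zc k = ⊥ := by
  rw [Zc, D.nonneg k hk, bot_inf_eq]

lemma Bc_zero (D : DGA F A) : D.Bc 0 = ⊥ := by
  rw [Bc, D.nonneg (0 - 1) (by norm_num), Submodule.map_bot]

lemma one_mem_Zc (D : DGA F A) : (1 : A) ∈ D.Zc 0 := by
  refine ⟨D.one_mem, ?_⟩
  have h := D.leibniz 1 1 D.one_mem
  simp only [mul_one, one_mul, zpow_zero, one_smul, left_eq_add] at h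
  exact h

lemma Zc_zero_le (D : DGA F A) (hconn : D.Connected) :
    D.Zc 0 ≤ Submodule.span F {(1 : A)} := by
  rintro a ⟨ha, ha'⟩
  obtain ⟨c, rfl⟩ := hconn a ha ha'
  exact Submodule.smul_mem _ _ (Submodule.mem_span_singleton_self _)

end DGA

lemma posProdSpan_of_nonpos (D : DGA F A) {k : ℤ} (hk : k ≤ 0) : posProdSpan D k = ⊥ := by
  rw [posProdSpan, Submodule.span_eq_bot]
  rintro x ⟨i, j, hi, hj, hij, -⟩
  omega

/-- Products of at least one element of `G`. -/
def prodSpan1 (G : ℤ → Submodule F A) : Submodule F A :=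
  Submodule.span F {a : A | ∃ l : List A, 1 ≤ l.length ∧
    (∀ x ∈ l, ∃ j : ℤ, x ∈ G j) ∧ a = l.prod}

lemma le_prodSpan1 (G : ℤ → Submodule F A) (k : ℤ) : G k ≤ prodSpan1 G := by
  intro x hx
  refine Submodule.subset_span ⟨[x], by simp, ?_, by simp⟩
  intro y hy
  rw [List.mem_singleton] at hy
  exact ⟨k, hy ▸ hx⟩

lemma prodSpan2_le_prodSpan1 (G : ℤ → Submodule F A) : prodSpan2 G ≤ prodSpan1 G := by
  apply Submodule.span_mono
  rintro a ⟨l, hl, h⟩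
  exact ⟨l, by omega, h⟩

lemma prodSpan1_mul_le (G : ℤ → Submodule F A) :
    prodSpan1 G * prodSpan1 G ≤ prodSpan2 G := by
  rw [prodSpan1, Submodule.span_mul_span]
  apply Submodule.span_mono
  rintro _ ⟨_, ⟨l, hl, h, rfl⟩, _, ⟨l', hl', h', rfl⟩, rfl⟩
  refine ⟨l ++ l', by rw [List.length_append]; omega, ?_, by simp⟩
  intro x hx
  rcases List.mem_append.1 hx with hx | hx
  exacts [h x hx, h' x hx]

/-- A nonempty product of elements of a generating family is a cocycle of positive degree. -/
lemma list_prod_mem_Zc {D : DGA F A} {G : ℤ → Submodule F A} (hG : IsGeneratingFamily D G)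
    (l : List A) (hl : l ≠ []) (h : ∀ x ∈ l, ∃ j : ℤ, x ∈ G j) :
    ∃ k : ℤ, 1 ≤ k ∧ l.prod ∈ D.Zc k := by
  have key : ∀ x : A, (∃ j : ℤ, x ∈ G j) → ∃ k : ℤ, 1 ≤ k ∧ x ∈ D.Zc k := by
    rintro x ⟨j, hj⟩
    rcases le_or_gt j 0 with h0 | h0
    · rw [hG.2.1 j h0, Submodule.mem_bot] at hj
      exact ⟨1, le_rfl, hj ▸ zero_mem _⟩
    · exact ⟨j, h0, hG.1 j hj⟩
  induction l with
  | nil => exact absurd rfl hl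
  | cons x l ih =>
    obtain ⟨i, hi, hx⟩ := key x (h x (by simp))
    rcases eq_or_ne l [] with rfl | hl'
    · exact ⟨i, hi, by simpa using hx⟩
    · obtain ⟨j, hj, hl''⟩ := ih hl' fun y hy => h y (by simp [hy])
      exact ⟨i + j, by omega, by rw [List.prod_cons]; exact D.mul_mem_Zc hx hl''⟩

lemma list_prod_mem_posProdSpan {D : DGA F A} {G : ℤ → Submodule F A}
    (hG : IsGeneratingFamily D G) (l : List A) (hl : 2 ≤ l.length)
    (h : ∀ x ∈ l, ∃ j : ℤ, x ∈ G j) :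
    ∃ k : ℤ, l.prod ∈ D.Zc k ∧ l.prod ∈ posProdSpan D k := by
  match l, hl, h with
  | x :: y :: l, _, h =>
    obtain ⟨i, hi, hx⟩ := list_prod_mem_Zc hG [x] (by simp) fun z hz => h z (by simp_all)
    obtain ⟨j, hj, hy⟩ := list_prod_mem_Zc hG (y :: l) (by simp)
      fun z hz => h z (List.mem_cons_of_mem _ hz)
    rw [List.prod_singleton] at hx
    rw [List.prod_cons (a := x)]
    exact ⟨i + j, D.mul_mem_Zc hx hy,
      Submodule.subset_span ⟨i, j, hi, hj, rfl, x, hx, _, hy, rfl⟩⟩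

lemma prodSpan2_inf_Zc_le {D : DGA F A} {G : ℤ → Submodule F A}
    (hG : IsGeneratingFamily D G) (k : ℤ) : prodSpan2 G ⊓ D.Zc k ≤ posProdSpan D k := by
  obtain ⟨p, hp, hp'⟩ := D.exists_proj k
  have key : prodSpan2 G ≤ (posProdSpan D k).comap p := by
    refine Submodule.span_le.2 ?_
    rintro _ ⟨l, hl, h, rfl⟩
    obtain ⟨j, hj, hj'⟩ := list_prod_mem_posProdSpan hG l hl h
    rw [SetLike.mem_coe, Submodule.mem_comap]
    rcases eq_or_ne j k with rfl | hjk
    · rwa [hp _ hj.1]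
    · rw [hp' j hjk _ hj.1]
      exact zero_mem _
  rintro x ⟨hx, hx'⟩
  have h := key hx
  rwa [Submodule.mem_comap, hp x hx'.1] at h

lemma posProdSpan_le {D : DGA F A} {G : ℤ → Submodule F A}
    (hG : IsGeneratingFamily D G) (k : ℤ) :
    posProdSpan D k ≤ (prodSpan2 G ⊓ D.Zc k) ⊔ D.Bc k := by
  suffices H : ∀ (N : ℕ) (k : ℤ), k ≤ N →
      posProdSpan D k ≤ (prodSpan2 G ⊓ D.Zc k) ⊔ D.Bc k from H k.toNat k (Int.self_le_toNat k)
  intro N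
  induction N with
  | zero =>
    intro k hk
    rw [posProdSpan_of_nonpos D (by simpa using hk)]
    exact bot_le
  | succ N ih =>
    intro k hk
    push_cast at hk
    have cover : ∀ i : ℤ, 1 ≤ i → i ≤ N → D.Zc i ≤ (prodSpan1 G ⊓ D.Zc i) ⊔ D.Bc i := by
      intro i hi hiN
      refine (hG.2.2.2 i hi).trans (sup_le (sup_le ?_ ((ih i hiN).trans ?_)) le_sup_right)
      · exact (le_inf (le_prodSpan1 G i) (hG.1 i)).trans le_sup_left
      · exact sup_le_sup_right (inf_le_inf_right _ (prodSpan2_le_prodSpan1 G)) _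
    refine Submodule.span_le.2 ?_
    rintro _ ⟨i, j, hi, hj, rfl, a, ha, b, hb, rfl⟩
    obtain ⟨a', ha', α, hα, rfl⟩ := Submodule.mem_sup.1 (cover i hi (by omega) ha)
    obtain ⟨b', hb', β, hβ, rfl⟩ := Submodule.mem_sup.1 (cover j hj (by omega) hb)
    refine Submodule.mem_sup.2 ⟨a' * b', ⟨prodSpan1_mul_le G (Submodule.mul_mem_mul ha'.1 hb'.1),
      D.mul_mem_Zc ha'.2 hb'.2⟩, a' * β + α * (b' + β),
      add_mem (D.mul_Bc_mem ha'.2 hβ) (D.Bc_mul_mem hα hb), ?_⟩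
    noncomm_ring

/-- The family `G` together with the line spanned by the unit in degree `0`. -/
def unitalFamily (G : ℤ → Submodule F A) (k : ℤ) : Submodule F A :=
  if k = 0 then Submodule.span F {1} else G k

lemma adjoin_inf_Zc_le {D : DGA F A} {G : ℤ → Submodule F A}
    (hG : IsGeneratingFamily D G) (k : ℤ) :
    Subalgebra.toSubmodule (Algebra.adjoin F {a : A | ∃ j : ℤ, a ∈ G j}) ⊓ D.Zc k ≤
      unitalFamily G k ⊔ (prodSpan2 G ⊓ D.Zc k) := by
  obtain ⟨p, hp, hp'⟩ := D.exists_proj k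
  have key : Subalgebra.toSubmodule (Algebra.adjoin F {a : A | ∃ j : ℤ, a ∈ G j}) ≤
      (unitalFamily G k ⊔ (prodSpan2 G ⊓ D.Zc k)).comap p := by
    rw [Algebra.adjoin_eq_span, Submodule.span_le]
    intro x hx
    obtain ⟨l, hl, rfl⟩ := Submonoid.exists_list_of_mem_closure hx
    rw [SetLike.mem_coe, Submodule.mem_comap]
    match l, hl with
    | [], _ =>
      rw [List.prod_nil]
      rcases eq_or_ne k 0 with rfl | hk
      · rw [hp 1 D.one_mem]
        refine Submodule.mem_sup_left ?_
        rw [unitalFamily, if_pos rfl]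
        exact Submodule.mem_span_singleton_self _
      · rw [hp' 0 hk.symm 1 D.one_mem]
        exact zero_mem _
    | [x], hl =>
      rw [List.prod_singleton]
      obtain ⟨j, hj⟩ := hl x (by simp)
      rcases eq_or_ne j k with rfl | hjk
      · rw [hp x (hG.1 j hj).1]
        rcases eq_or_ne j 0 with rfl | hj0
        · rw [hG.2.1 0 le_rfl, Submodule.mem_bot] at hj
          rw [hj]
          exact zero_mem _
        · refine Submodule.mem_sup_left ?_
          rwa [unitalFamily, if_neg hj0]
      · rw [hp' j hjk x (hG.1 j hj).1]
        exact zero_mem _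
    | x :: y :: l, hl =>
      obtain ⟨j, hj, -⟩ := list_prod_mem_posProdSpan hG (x :: y :: l) (by simp) hl
      rcases eq_or_ne j k with rfl | hjk
      · rw [hp _ hj.1]
        exact Submodule.mem_sup_right ⟨Submodule.subset_span ⟨_, by simp, hl, rfl⟩, hj⟩
      · rw [hp' j hjk _ hj.1]
        exact zero_mem _
  rintro x ⟨hx, hx'⟩
  have h := key hx
  rwa [Submodule.mem_comap, hp x hx'.1] at h

lemma prodSpan2_le_adjoin (G : ℤ → Submodule F A) :
    prodSpan2 G ≤ Subalgebra.toSubmodule (Algebra.adjoin F {a : A | ∃ j : ℤ, a ∈ G j}) := by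
  refine Submodule.span_le.2 ?_
  rintro _ ⟨l, -, h, rfl⟩
  exact Subalgebra.list_prod_mem _ fun x hx => Algebra.subset_adjoin (h x hx)

lemma unitalFamily_le_adjoin (G : ℤ → Submodule F A) (k : ℤ) :
    unitalFamily G k ≤
      Subalgebra.toSubmodule (Algebra.adjoin F {a : A | ∃ j : ℤ, a ∈ G j}) := by
  rw [unitalFamily]
  split_ifs
  · rw [Submodule.span_singleton_le_iff_mem]
    exact Subalgebra.one_mem _
  · exact fun x hx => Algebra.subset_adjoin ⟨k, hx⟩

lemma unitalFamily_le_Zc {D : DGA F A} {G : ℤ → Submodule F A}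
    (hG : IsGeneratingFamily D G) (k : ℤ) : unitalFamily G k ≤ D.Zc k := by
  rw [unitalFamily]
  split_ifs with hk
  · subst hk
    rw [Submodule.span_singleton_le_iff_mem]
    exact D.one_mem_Zc
  · exact hG.1 k

lemma le_unitalFamily {D : DGA F A} {G : ℤ → Submodule F A}
    (hG : IsGeneratingFamily D G) (k : ℤ) : G k ≤ unitalFamily G k := by
  rw [unitalFamily]
  split_ifs with hk
  · rw [hG.2.1 k hk.le]
    exact bot_le
  · exact le_rfl

lemma disjoint_unitalFamily {D : DGA F A} {G : ℤ → Submodule F A}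
    (hG : IsGeneratingFamily D G) (k : ℤ) :
    Disjoint (unitalFamily G k) ((prodSpan2 G ⊓ D.Zc k) ⊔ D.Bc k) := by
  refine Disjoint.mono_right (sup_le_sup_right (prodSpan2_inf_Zc_le hG k) _) ?_
  rcases eq_or_ne k 0 with rfl | hk
  · rw [posProdSpan_of_nonpos D le_rfl, D.Bc_zero, bot_sup_eq]
    exact disjoint_bot_right
  · rw [unitalFamily, if_neg hk]
    exact hG.2.2.1 k

lemma Zc_le_unitalFamily_sup {D : DGA F A} (hconn : D.Connected) {G : ℤ → Submodule F A}
    (hG : IsGeneratingFamily D G) (k : ℤ) :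
    D.Zc k ≤ unitalFamily G k ⊔ ((prodSpan2 G ⊓ D.Zc k) ⊔ D.Bc k) := by
  rcases lt_trichotomy k 0 with hk | rfl | hk
  · rw [D.Zc_eq_bot_of_neg hk]
    exact bot_le
  · rw [unitalFamily, if_pos rfl]
    exact (D.Zc_zero_le hconn).trans le_sup_left
  · rw [unitalFamily, if_neg hk.ne']
    refine (hG.2.2.2 k hk).trans ?_
    rw [sup_assoc]
    exact sup_le_sup_left (sup_le (posProdSpan_le hG k) le_sup_right) _

lemma unitalFamily_le_of_isAdaptedHarmonic {D : DGA F A}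
    {G H' : ℤ → Submodule F A} (hH : IsAdaptedHarmonic D G H') (k : ℤ) :
    unitalFamily G k ≤ H' k := by
  rw [unitalFamily]
  split_ifs with hk
  · subst hk
    have h := (hH.1 0).2.2
    rw [D.Bc_zero, bot_sup_eq] at h
    rw [Submodule.span_singleton_le_iff_mem]
    exact h D.one_mem_Zc
  · exact hH.2.1 k

lemma isAdaptedHarmonic_of_isSplittingFamily {D : DGA F A} (hconn : D.Connected)
    {G L : ℤ → Submodule F A} (hG : IsGeneratingFamily D G) (hL : IsSplittingFamily D G L) :
    IsAdaptedHarmonic D G fun k => unitalFamily G k ⊔ L k := by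
  refine ⟨fun k => ?_, fun k => (le_unitalFamily hG k).trans le_sup_left, fun k => ?_⟩
  · obtain ⟨h1, h2, h3⟩ := hL k
    refine ⟨sup_le (unitalFamily_le_Zc hG k) (h1.trans inf_le_right), ?_, ?_⟩
    · exact (h2.symm.disjoint_sup_right_of_disjoint_sup_left
        ((disjoint_unitalFamily hG k).symm.mono_left
          (sup_le le_sup_right (h1.trans le_sup_left)))).mono_right (sup_comm _ _).le
    · refine (Zc_le_unitalFamily_sup hconn hG k).trans (sup_le ?_ (sup_le (h3.trans ?_) ?_))
      · exact le_sup_left.trans le_sup_right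
      · exact sup_le (le_sup_right.trans le_sup_right) le_sup_left
      · exact le_sup_left
  · exact sup_le (unitalFamily_le_adjoin G k)
      (((hL k).1.trans inf_le_left).trans (prodSpan2_le_adjoin G))

lemma isSplittingFamily_of_isAdaptedHarmonic {D : DGA F A}
    {G H' : ℤ → Submodule F A} (hG : IsGeneratingFamily D G) (hH : IsAdaptedHarmonic D G H') :
    IsSplittingFamily D G fun k => H' k ⊓ (prodSpan2 G ⊓ D.Zc k) := by
  intro k
  obtain ⟨h1, h2, h3⟩ := hH.1 k
  refine ⟨inf_le_right, h2.symm.mono_left inf_le_left, ?_⟩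
  intro t ht
  obtain ⟨b, hb, h, hh, rfl⟩ := Submodule.mem_sup.1 (h3 ht.2)
  obtain ⟨g, hg, s, hs, rfl⟩ := Submodule.mem_sup.1
    (adjoin_inf_Zc_le hG k ⟨hH.2.2 k hh, h1 hh⟩)
  have hg0 : g = 0 := by
    refine (Submodule.disjoint_def.1 (disjoint_unitalFamily hG k)) g hg ?_
    have : g = ((b + (g + s)) - s) - b := by abel
    rw [this]
    exact sub_mem (Submodule.mem_sup_left (sub_mem ht hs)) (Submodule.mem_sup_right hb)
  subst hg0
  rw [zero_add] at hh ⊢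
  exact add_mem (Submodule.mem_sup_right hb) (Submodule.mem_sup_left ⟨hh, hs⟩)

lemma exists_isSplittingFamily (D : DGA F A) (G : ℤ → Submodule F A) :
    ∃ L : ℤ → Submodule F A, IsSplittingFamily D G L := by
  have key : ∀ k : ℤ, ∃ L : Submodule F A, L ≤ prodSpan2 G ⊓ D.Zc k ∧ Disjoint L (D.Bc k) ∧
      prodSpan2 G ⊓ D.Zc k ≤ L ⊔ D.Bc k := by
    intro k
    obtain ⟨C, hC⟩ := exists_isCompl (prodSpan2 G ⊓ D.Zc k ⊓ D.Bc k)
    refine ⟨C ⊓ (prodSpan2 G ⊓ D.Zc k), inf_le_right, ?_, ?_⟩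
    · rw [disjoint_iff, inf_assoc, inf_comm]
      exact hC.inf_eq_bot
    · intro t ht
      obtain ⟨b, hb, c, hc, rfl⟩ := Submodule.mem_sup.1
        (hC.sup_eq_top.ge (Submodule.mem_top (x := t)))
      refine add_mem (Submodule.mem_sup_right hb.2) (Submodule.mem_sup_left ⟨hc, ?_⟩)
      exact (Submodule.add_mem_iff_right _ hb.1).1 ht
  choose L hL using key
  exact ⟨L, hL⟩

/-- Adapted harmonic subspaces correspond to splittings of `ι₀(S*_{≥2}) → H*₊·H*₊`, by
intersecting with `ι₀(S*_{≥2})`, respectively adding `F·1` and `ι₀(H*_gen)`. -/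
def adaptedHarmonicEquiv {D : DGA F A} (hconn : D.Connected) {G : ℤ → Submodule F A}
    (hG : IsGeneratingFamily D G) :
    {H' : ℤ → Submodule F A // IsAdaptedHarmonic D G H'} ≃
      {L : ℤ → Submodule F A // IsSplittingFamily D G L} where
  toFun H' := ⟨_, isSplittingFamily_of_isAdaptedHarmonic hG H'.2⟩
  invFun L := ⟨_, isAdaptedHarmonic_of_isSplittingFamily hconn hG L.2⟩
  left_inv := by
    rintro ⟨H', hH⟩
    ext1
    funext k
    have hle : H' k ≤ unitalFamily G k ⊔ (prodSpan2 G ⊓ D.Zc k) :=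
      (le_inf (hH.2.2 k) (hH.1 k).1).trans (adjoin_inf_Zc_le hG k)
    change unitalFamily G k ⊔ H' k ⊓ (prodSpan2 G ⊓ D.Zc k) = H' k
    rw [inf_comm, ← sup_inf_assoc_of_le _ (unitalFamily_le_of_isAdaptedHarmonic hH k),
      inf_eq_right.2 hle]
  right_inv := by
    rintro ⟨L, hL⟩
    ext1
    funext k
    change (unitalFamily G k ⊔ L k) ⊓ (prodSpan2 G ⊓ D.Zc k) = L k
    rw [sup_comm, sup_inf_assoc_of_le _ (hL k).1,
      ((disjoint_unitalFamily hG k).mono_right le_sup_left).eq_bot, sup_bot_eq]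

/-- For a connected Poincaré DGCA, given a generating subspace and a
partial splitting map `ι₀` (encoded by the family `G` of its images), there exists an
`ι₀`-adapted harmonic subspace, i.e. a splitting `ι` of `pr : A*_d → H*(A*)` extending
`ι₀` with image in the subalgebra generated by `ι₀(H*_gen)`; moreover such splittings
are in one-to-one correspondence with splittings of `pr : ι₀(S*_{≥2}) → H*₊·H*₊`. -/
theorem statement_6 {n : ℤ} (P : PoincareDGCA F A n)
    (hconn : P.toDGA.Connected)
    (G : ℤ → Submodule F A) (hG : IsGeneratingFamily P.toDGA G) :
    (∃ H' : ℤ → Submodule F A, IsAdaptedHarmonic P.toDGA G H') ∧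
    Nonempty
      ({H' : ℤ → Submodule F A // IsAdaptedHarmonic P.toDGA G H'} ≃
       {L : ℤ → Submodule F A // IsSplittingFamily P.toDGA G L}) := by
  obtain ⟨L, hL⟩ := exists_isSplittingFamily P.toDGA G
  exact ⟨⟨_, isAdaptedHarmonic_of_isSplittingFamily hconn hG hL⟩,
    ⟨adaptedHarmonicEquiv hconn hG⟩⟩
end
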